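/- arXiv:2604.01429 — 7 statements merged into one kernel-verified Lean document; each statement's English description precedes it below -/
import Mathlib

section
/- If X ∈ End(V) commutes with R(g) for every g ∈ G and X maps each summand V_k into itself, then the measurement channel fixes X, i.e. M(X) = X. (Any orthonormal basis adapted to an irreducible decomposition — a Fourier basis — is trivial-centralizing with coefficient a_triv = 1.) -/
open Matrix
open scoped BigOperators

noncomputable section

/-- The classical-shadows measurement channel determined by the unitary ensemble `R`
(sampled uniformly over the finite group `G`) and the orthonormal measurement basis `w`:
`M(X) = (1/|G|) Σ_{g∈G} Σ_{i=1}^d ⟨w_i, R(g) X R(g)* w_i⟩ · R(g)* |w_i⟩⟨w_i| R(g)`. -/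
def mChannel {G : Type*} [Group G] [Fintype G] {d : ℕ}
    (R : G →* Matrix.unitaryGroup (Fin d) ℂ) (w : Fin d → Fin d → ℂ)
    (X : Matrix (Fin d) (Fin d) ℂ) : Matrix (Fin d) (Fin d) ℂ :=
  ((Fintype.card G : ℂ))⁻¹ •
    ∑ g : G, ∑ i : Fin d,
      (∑ x, star (w i x) *
        (((R g : Matrix (Fin d) (Fin d) ℂ) * X *
            star (R g : Matrix (Fin d) (Fin d) ℂ)).mulVec (w i)) x) •
      (star (R g : Matrix (Fin d) (Fin d) ℂ) *
        Matrix.vecMulVec (w i) (star (w i)) * (R g : Matrix (Fin d) (Fin d) ℂ))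

/-- The spectral projection of a Hermitian matrix onto the eigenspace of `c`. -/
def spectralProj {n : Type*} [Fintype n] [DecidableEq n] {H : Matrix n n ℂ}
    (hH : H.IsHermitian) (c : ℝ) : Matrix n n ℂ :=
  (hH.eigenvectorUnitary : Matrix n n ℂ) *
    diagonal (fun i => if hH.eigenvalues i = c then (1 : ℂ) else 0) *
    star (hH.eigenvectorUnitary : Matrix n n ℂ)

section Schur

variable {n : Type*} [Fintype n] [DecidableEq n]

lemma Matrix.IsHermitian.eq_conj_diagonal {H : Matrix n n ℂ} (hH : H.IsHermitian) :
    H = (hH.eigenvectorUnitary : Matrix n n ℂ) *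
      diagonal (fun i => (hH.eigenvalues i : ℂ)) *
      star (hH.eigenvectorUnitary : Matrix n n ℂ) := by
  conv_lhs => rw [hH.spectral_theorem]
  rfl

lemma spectralProj_mul_self {H : Matrix n n ℂ} (hH : H.IsHermitian) (c : ℝ) :
    spectralProj hH c * spectralProj hH c = spectralProj hH c := by
  have hU : star (hH.eigenvectorUnitary : Matrix n n ℂ) * hH.eigenvectorUnitary = 1 :=
    Unitary.coe_star_mul_self _
  simp only [spectralProj, Matrix.mul_assoc]
  rw [← Matrix.mul_assoc (star _) (hH.eigenvectorUnitary : Matrix n n ℂ), hU, Matrix.one_mul,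
    ← Matrix.mul_assoc (diagonal _) (diagonal _), diagonal_mul_diagonal]
  congr 3
  ext i
  by_cases h : hH.eigenvalues i = c <;> simp [h]

lemma spectralProj_conjTranspose {H : Matrix n n ℂ} (hH : H.IsHermitian) (c : ℝ) :
    (spectralProj hH c)ᴴ = spectralProj hH c := by
  simp only [spectralProj, conjTranspose_mul, star_eq_conjTranspose, conjTranspose_conjTranspose,
    diagonal_conjTranspose, Matrix.mul_assoc]
  congr 3
  ext i
  simp [apply_ite]

lemma mul_spectralProj {H : Matrix n n ℂ} (hH : H.IsHermitian) (c : ℝ) :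
    H * spectralProj hH c = (c : ℂ) • spectralProj hH c := by
  have hU : star (hH.eigenvectorUnitary : Matrix n n ℂ) * hH.eigenvectorUnitary = 1 :=
    Unitary.coe_star_mul_self _
  rw [congrArg (· * spectralProj hH c) hH.eq_conj_diagonal]
  simp only [spectralProj, Matrix.mul_assoc]
  rw [← Matrix.mul_assoc (star _) (hH.eigenvectorUnitary : Matrix n n ℂ), hU, Matrix.one_mul,
    ← Matrix.mul_assoc (diagonal _) (diagonal _), diagonal_mul_diagonal,
    ← Matrix.mul_smul, ← Matrix.smul_mul, ← diagonal_smul]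
  congr 3
  ext i
  by_cases h : hH.eigenvalues i = c <;> simp [h]

/-- Spectral projections of `H` commute with everything that commutes with `H`. -/
lemma commute_spectralProj {H : Matrix n n ℂ} (hH : H.IsHermitian) (c : ℝ) {B : Matrix n n ℂ}
    (hB : Commute B H) : Commute B (spectralProj hH c) := by
  set U := (hH.eigenvectorUnitary : Matrix n n ℂ) with hUdef
  have hU : star U * U = 1 := Unitary.coe_star_mul_self _
  have hU' : U * star U = 1 := Unitary.coe_mul_star_self _
  have conj (D : Matrix n n ℂ) :
      Commute B (U * D * star U) ↔ Commute (star U * B * U) D := by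
    constructor <;> intro h
    · calc star U * B * U * D = star U * (B * (U * D * star U)) * U := by
            simp only [Matrix.mul_assoc, hU, Matrix.mul_one]
        _ = star U * ((U * D * star U) * B) * U := by rw [h.eq]
        _ = (star U * U) * D * (star U * B * U) := by simp only [Matrix.mul_assoc]
        _ = D * (star U * B * U) := by rw [hU, Matrix.one_mul]
    · calc B * (U * D * star U) = (U * star U) * B * (U * D * star U) := by
            rw [hU', Matrix.one_mul]
        _ = U * ((star U * B * U) * D) * star U := by simp only [Matrix.mul_assoc]
        _ = U * (D * (star U * B * U)) * star U := by rw [h.eq]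
        _ = U * D * star U * B * (U * star U) := by simp only [Matrix.mul_assoc]
        _ = U * D * star U * B := by rw [hU', Matrix.mul_one]
  rw [hH.eq_conj_diagonal, conj] at hB
  rw [spectralProj, conj]
  ext i j
  have h := congrFun (congrFun hB.eq i) j
  simp only [mul_diagonal, diagonal_mul] at h ⊢
  by_cases hij : hH.eigenvalues i = hH.eigenvalues j
  · rw [hij, mul_comm]
  · have h0 : (star U * B * U) i j = 0 := by
      have hsub : ((hH.eigenvalues i : ℂ) - hH.eigenvalues j) * (star U * B * U) i j = 0 := by
        linear_combination -h
      refine (mul_eq_zero.mp hsub).resolve_left fun h' => hij ?_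
      exact_mod_cast sub_eq_zero.mp h'
    rw [h0, zero_mul, mul_zero]

lemma exists_spectralProj_mul_ne_zero {H P : Matrix n n ℂ} (hH : H.IsHermitian) (hP : P ≠ 0) :
    ∃ c, spectralProj hH c * P ≠ 0 := by
  by_contra! h
  apply hP
  set U := (hH.eigenvectorUnitary : Matrix n n ℂ) with hUdef
  have hU : star U * U = 1 := Unitary.coe_star_mul_self _
  have hU' : U * star U = 1 := Unitary.coe_mul_star_self _
  have hz : star U * P = 0 := by
    ext i j
    have h1 : star U * (spectralProj hH (hH.eigenvalues i) * P) = 0 := by rw [h, Matrix.mul_zero]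
    simp only [spectralProj, ← hUdef, Matrix.mul_assoc] at h1
    rw [← Matrix.mul_assoc (star U) U, hU, Matrix.one_mul] at h1
    simpa using congrFun (congrFun h1 i) j
  rw [← Matrix.one_mul P, ← hU', Matrix.mul_assoc, hz, Matrix.mul_zero]

/-- Schur's lemma for Hermitian intertwiners of an irreducible summand. -/
lemma schur_hermitian (S : Set (Matrix n n ℂ)) {P H : Matrix n n ℂ}
    (hPP : P * P = P) (hPsa : Pᴴ = P) (hSP : ∀ B ∈ S, Commute B P)
    (hirr : ∀ Q : Matrix n n ℂ, Q * Q = Q → Qᴴ = Q → Q * P = Q → P * Q = Q →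
      (∀ B ∈ S, Commute B Q) → Q = 0 ∨ Q = P)
    (hH : H.IsHermitian) (hHP : H * P = H) (hSH : ∀ B ∈ S, Commute B H) :
    ∃ c : ℂ, H = c • P := by
  have hPH : P * H = H := by
    simpa [conjTranspose_mul, hPsa, hH.eq] using congrArg conjTranspose hHP
  by_cases hP : P = 0
  · exact ⟨0, by rw [← hHP, hP, Matrix.mul_zero, smul_zero]⟩
  obtain ⟨c, hc⟩ := exists_spectralProj_mul_ne_zero hH hP
  have hcomm : Commute P (spectralProj hH c) :=
    commute_spectralProj hH c (hPH.trans hHP.symm)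
  have hE : spectralProj hH c * P = P := by
    refine (hirr _ ?_ ?_ ?_ ?_ ?_).resolve_left hc
    · rw [Matrix.mul_assoc, ← Matrix.mul_assoc P, hcomm.eq, Matrix.mul_assoc, hPP,
        ← Matrix.mul_assoc, spectralProj_mul_self]
    · rw [conjTranspose_mul, hPsa, spectralProj_conjTranspose, hcomm.eq]
    · rw [Matrix.mul_assoc, hPP]
    · rw [← Matrix.mul_assoc, hcomm.eq, Matrix.mul_assoc, hPP]
    · exact fun B hB => (commute_spectralProj hH c (hSH B hB)).mul_right (hSP B hB)
  refine ⟨c, ?_⟩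
  rw [← hHP, ← hE, ← Matrix.mul_assoc, mul_spectralProj, Matrix.smul_mul]

/-- Schur's lemma: an intertwiner of an irreducible summand of a star-closed family of matrices
is a scalar multiple of the projection onto that summand. -/
lemma schur_projection (S : Set (Matrix n n ℂ)) (hS : ∀ B ∈ S, Bᴴ ∈ S) {P A : Matrix n n ℂ}
    (hPP : P * P = P) (hPsa : Pᴴ = P) (hSP : ∀ B ∈ S, Commute B P)
    (hirr : ∀ Q : Matrix n n ℂ, Q * Q = Q → Qᴴ = Q → Q * P = Q → P * Q = Q →
      (∀ B ∈ S, Commute B Q) → Q = 0 ∨ Q = P)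
    (hAP : A * P = A) (hPA : P * A = A) (hSA : ∀ B ∈ S, Commute B A) :
    ∃ c : ℂ, A = c • P := by
  have hAP' : Aᴴ * P = Aᴴ := by
    simpa [conjTranspose_mul, hPsa] using congrArg conjTranspose hPA
  have hSA' : ∀ B ∈ S, Commute B Aᴴ := fun B hB => by
    simpa [commute_iff_eq, conjTranspose_mul] using (congrArg conjTranspose (hSA _ (hS B hB)).eq).symm
  obtain ⟨a, ha⟩ := schur_hermitian S hPP hPsa hSP hirr (H := A + Aᴴ)
    (by simp [IsHermitian, add_comm]) (by rw [Matrix.add_mul, hAP, hAP'])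
    (fun B hB => (hSA B hB).add_right (hSA' B hB))
  obtain ⟨b, hb⟩ := schur_hermitian S hPP hPsa hSP hirr (H := Complex.I • (A - Aᴴ))
    (by simp [IsHermitian, ← smul_neg])
    (by rw [Matrix.smul_mul, Matrix.sub_mul, hAP, hAP'])
    (fun B hB => ((hSA B hB).sub_right (hSA' B hB)).smul_right _)
  refine ⟨(a - Complex.I * b) / 2, ?_⟩
  have hb' : A - Aᴴ = (-Complex.I * b) • P := by
    rw [mul_smul, ← hb, smul_smul]
    simp
  have h2 : (2 : ℂ) • A = (a - Complex.I * b) • P := by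
    rw [two_smul, sub_eq_add_neg, ← neg_mul, add_smul, ← ha, ← hb']
    abel
  rw [div_eq_inv_mul, mul_smul, ← h2, smul_smul]
  simp

/-- Completeness relation for an orthonormal basis. -/
lemma sum_vecMulVec_star_eq_one (w : n → n → ℂ)
    (horth : ∀ i j, (∑ x, star (w i x) * w j x) = if i = j then 1 else 0) :
    ∑ i, vecMulVec (w i) (star (w i)) = 1 := by
  have h : (of w).map star * (of w)ᵀ = 1 := by
    ext i j
    simpa [mul_apply, one_apply] using horth i j
  rw [mul_eq_one_comm] at h
  rw [← h]
  ext x y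
  simp [mul_apply, Matrix.sum_apply, vecMulVec_apply]

end Schur

/-- Let `R : G → U(d)` be a unitary representation of the finite group `G`
on `V = ℂ^d`, and let `V = V₁ ⊕ ⋯ ⊕ V_m` be an orthogonal direct sum of `R`-invariant
irreducible subspaces, with `P k` the orthogonal projection onto `V_k`.  Let `(w_i)` be an
orthonormal basis adapted to this decomposition (a Fourier basis, `w i ∈ V_{k i}`).
If `X` commutes with every `R g` and maps each summand `V_k` into itself, then the
measurement channel fixes `X`: `M(X) = X`. -/
theorem fourier_basis_trivial_centralizing
    (G : Type*) [Group G] [Fintype G] (d m : ℕ)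
    (R : G →* Matrix.unitaryGroup (Fin d) ℂ)
    -- the orthogonal projections onto the summands V_1, ..., V_m
    (P : Fin m → Matrix (Fin d) (Fin d) ℂ)
    (hPproj : ∀ k, P k * P k = P k)
    (hPsa : ∀ k, (P k)ᴴ = P k)
    (hPorth : ∀ k l, k ≠ l → P k * P l = 0)
    (hPsum : ∑ k, P k = 1)
    -- each summand is R-invariant
    (hPinv : ∀ (g : G) k, (R g : Matrix (Fin d) (Fin d) ℂ) * P k
        = P k * (R g : Matrix (Fin d) (Fin d) ℂ))
    -- each summand is irreducible as a G-module (no proper nonzero invariant subspace)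
    (hirr : ∀ k (Q : Matrix (Fin d) (Fin d) ℂ), Q * Q = Q → Qᴴ = Q →
        Q * P k = Q → P k * Q = Q →
        (∀ g : G, (R g : Matrix (Fin d) (Fin d) ℂ) * Q
          = Q * (R g : Matrix (Fin d) (Fin d) ℂ)) →
        Q = 0 ∨ Q = P k)
    -- an orthonormal basis adapted to the decomposition
    (w : Fin d → Fin d → ℂ)
    (horth : ∀ i j, (∑ x, star (w i x) * w j x) = if i = j then 1 else 0)
    (k : Fin d → Fin m)
    (hadapt : ∀ i, (P (k i)).mulVec (w i) = w i)
    -- the operator X: commutes with the representation and preserves each summand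
    (X : Matrix (Fin d) (Fin d) ℂ)
    (hXcomm : ∀ g : G, (R g : Matrix (Fin d) (Fin d) ℂ) * X
        = X * (R g : Matrix (Fin d) (Fin d) ℂ))
    (hXdiag : ∀ l, P l * X * P l = X * P l) :
    mChannel R w X = X := by
  set ρ : G → Matrix (Fin d) (Fin d) ℂ := fun g => (R g : Matrix (Fin d) (Fin d) ℂ) with hρ
  have hρs (g : G) : star (ρ g) * ρ g = 1 := Unitary.coe_star_mul_self _
  have hρs' (g : G) : ρ g * star (ρ g) = 1 := Unitary.coe_mul_star_self _
  have hstar : ∀ B ∈ Set.range ρ, Bᴴ ∈ Set.range ρ := by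
    rintro _ ⟨g, rfl⟩
    refine ⟨g⁻¹, ?_⟩
    simp only [hρ, map_inv]
    rfl
  have hschur (l : Fin m) : ∃ c : ℂ, X * P l = c • P l := by
    refine schur_projection (Set.range ρ) hstar (hPproj l) (hPsa l) ?_ ?_ ?_ ?_ ?_
    · rintro _ ⟨g, rfl⟩
      exact hPinv g l
    · intro Q h1 h2 h3 h4 h5
      exact hirr l Q h1 h2 h3 h4 fun g => h5 _ ⟨g, rfl⟩
    · rw [Matrix.mul_assoc, hPproj]
    · rw [← Matrix.mul_assoc, hXdiag]
    · rintro _ ⟨g, rfl⟩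
      exact Commute.mul_right (hXcomm g) (hPinv g l)
  choose c hc using hschur
  have hXw (i : Fin d) : X *ᵥ w i = c (k i) • w i := by
    conv_lhs => rw [← hadapt i]
    rw [mulVec_mulVec, hc, smul_mulVec, hadapt]
  have hX : ∑ i, c (k i) • vecMulVec (w i) (star (w i)) = X := by
    conv_rhs => rw [← Matrix.mul_one X, ← sum_vecMulVec_star_eq_one w horth, Matrix.mul_sum]
    refine Finset.sum_congr rfl fun i _ => ?_
    rw [mul_vecMulVec, hXw, smul_vecMulVec]
  have hterm (g : G) : ∑ i : Fin d,
      (∑ x, star (w i x) * ((ρ g * X * star (ρ g)) *ᵥ w i) x) •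
        (star (ρ g) * vecMulVec (w i) (star (w i)) * ρ g) = X := by
    have hconj : ρ g * X * star (ρ g) = X := by
      rw [hXcomm g, Matrix.mul_assoc, hρs', Matrix.mul_one]
    have hcoef (i : Fin d) : ∑ x, star (w i x) * (X *ᵥ w i) x = c (k i) := by
      simp only [hXw, Pi.smul_apply, smul_eq_mul, mul_left_comm, ← Finset.mul_sum]
      rw [horth, if_pos rfl, mul_one]
    have hconj' : star (ρ g) * X * ρ g = X := by
      rw [Matrix.mul_assoc, ← hXcomm g, ← Matrix.mul_assoc, hρs, Matrix.one_mul]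
    simp only [hconj, hcoef]
    conv_rhs => rw [← hconj', ← hX]
    simp only [Matrix.mul_sum, Matrix.sum_mul, Matrix.mul_smul, Matrix.smul_mul]
  have hcard : (Fintype.card G : ℂ) ≠ 0 := Nat.cast_ne_zero.mpr Fintype.card_ne_zero
  rw [mChannel, Finset.sum_congr rfl fun g _ => hterm g, Finset.sum_const, Finset.card_univ,
    ← Nat.cast_smul_eq_nsmul ℂ, smul_smul, inv_mul_cancel₀ hcard, one_smul]
end
end

section
/- For every X ∈ End(V): Σ_{i=1}^d ⟨w_i, X w_i⟩ |w_i⟩⟨w_i| = (1/|H|) Σ_{h∈H} ρ(h) P_D(X) ρ(h)*. That is, the dephasing map in a non-degenerate commuting-subgroup eigenbasis equals the H-twirl composed with the block-diagonal projection P_D. -/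
open Matrix
open scoped BigOperators

noncomputable section

section Sesquilinear

variable {n : Type*} [Fintype n]

theorem eq_of_orthonormal_sesquilinear_eq [DecidableEq n] {w : n → n → ℂ}
    (horth : ∀ i j, star (w i) ⬝ᵥ w j = if i = j then 1 else 0)
    {Y Z : Matrix n n ℂ}
    (h : ∀ i j, star (w i) ⬝ᵥ Y *ᵥ w j = star (w i) ⬝ᵥ Z *ᵥ w j) : Y = Z := by
  let W : Matrix n n ℂ := (Matrix.of w)ᵀ
  have hentry (A : Matrix n n ℂ) (i j : n) :
      (Wᴴ * (A * W)) i j = star (w i) ⬝ᵥ A *ᵥ w j := rfl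
  have hW : Wᴴ * W = 1 := by
    ext i j
    rw [Matrix.one_apply, ← horth]
    rfl
  have hW' : W * Wᴴ = 1 := mul_eq_one_comm.mp hW
  have hYZ : Wᴴ * (Y * W) = Wᴴ * (Z * W) := by
    ext i j
    rw [hentry, hentry, h]
  have hconj (A : Matrix n n ℂ) : W * (Wᴴ * (A * W)) * Wᴴ = A := by
    rw [← Matrix.mul_assoc, hW', Matrix.one_mul, Matrix.mul_assoc, hW', Matrix.mul_one]
  rw [← hconj Y, hYZ, hconj]

theorem star_dotProduct_mul_mul_mulVec (A Y B : Matrix n n ℂ) (u v : n → ℂ) :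
    star u ⬝ᵥ (A * Y * B) *ᵥ v = star (Aᴴ *ᵥ u) ⬝ᵥ Y *ᵥ (B *ᵥ v) := by
  rw [Matrix.star_mulVec, Matrix.conjTranspose_conjTranspose, ← Matrix.dotProduct_mulVec,
    Matrix.mulVec_mulVec, Matrix.mulVec_mulVec, Matrix.mul_assoc]

theorem star_dotProduct_sum_vecMulVec_mulVec [DecidableEq n] {w : n → n → ℂ}
    (horth : ∀ i j, star (w i) ⬝ᵥ w j = if i = j then 1 else 0) (c : n → ℂ) (i j : n) :
    star (w i) ⬝ᵥ (∑ a, c a • Matrix.vecMulVec (w a) (star (w a))) *ᵥ w j =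
      if i = j then c i else 0 := by
  simp only [Matrix.sum_mulVec, dotProduct_sum, Matrix.smul_mulVec, Matrix.vecMulVec_mulVec,
    dotProduct_smul, horth]
  rw [Finset.sum_eq_single i]
  · by_cases h : i = j <;> simp [h]
  · intro a _ ha
    simp [Ne.symm ha]
  · simp

theorem star_dotProduct_blockDiagonal_mulVec {κ : Type*} [Fintype κ] [DecidableEq κ]
    {P : κ → Matrix n n ℂ} (hPsa : ∀ l, (P l)ᴴ = P l) {k : n → κ} {w : n → n → ℂ}
    (hP : ∀ l i, P l *ᵥ w i = if l = k i then w i else 0) (X : Matrix n n ℂ) (i j : n) :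
    star (w i) ⬝ᵥ (∑ l, P l * X * P l) *ᵥ w j =
      if k i = k j then star (w i) ⬝ᵥ X *ᵥ w j else 0 := by
  simp only [Matrix.sum_mulVec, dotProduct_sum, star_dotProduct_mul_mul_mulVec, hPsa, hP]
  rw [Finset.sum_eq_single (k j)]
  · by_cases h : k i = k j
    · simp [h]
    · simp [h, Ne.symm h]
  · intro l _ hl
    simp [hl]
  · simp

end Sesquilinear

section Eigenvector

variable {H n : Type*} [CommGroup H] [Fintype n] [DecidableEq n]

/-- The character by which a group acts on a common eigenvector of unit norm. -/
def eigenCharacter (ρ : H →* Matrix.unitaryGroup n ℂ) (v : n → ℂ) (hv : star v ⬝ᵥ v = 1)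
    (χ : H → ℂ) (hχ : ∀ h, (ρ h : Matrix n n ℂ) *ᵥ v = χ h • v) : H →* ℂ where
  toFun := χ
  map_one' := by
    have h := congrArg (star v ⬝ᵥ ·) (hχ 1)
    simpa [hv, dotProduct_smul] using h.symm
  map_mul' a b := by
    have h := congrArg (star v ⬝ᵥ ·) (hχ (a * b))
    rw [map_mul, Submonoid.coe_mul, ← Matrix.mulVec_mulVec, hχ, Matrix.mulVec_smul, hχ] at h
    simpa [hv, dotProduct_smul, mul_comm] using h.symm

theorem conjTranspose_map_eq_map_inv (ρ : H →* Matrix.unitaryGroup n ℂ) (h : H) :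
    (ρ h : Matrix n n ℂ)ᴴ = (ρ h⁻¹ : Matrix n n ℂ) := by
  rw [map_inv]
  rfl

theorem star_eigenvalue_eq_inv {ρ : H →* Matrix.unitaryGroup n ℂ} {v : n → ℂ}
    (hv : star v ⬝ᵥ v = 1) {χ : H → ℂ} (hχ : ∀ h, (ρ h : Matrix n n ℂ) *ᵥ v = χ h • v)
    (h : H) : star (χ h) = χ h⁻¹ := by
  have h₁ : star v ⬝ᵥ (ρ h⁻¹ : Matrix n n ℂ) *ᵥ v = χ h⁻¹ := by
    rw [hχ, dotProduct_smul, hv, smul_eq_mul, mul_one]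
  rw [← h₁, ← conjTranspose_map_eq_map_inv, Matrix.dotProduct_mulVec, ← Matrix.star_mulVec,
    hχ, star_smul, smul_dotProduct, hv, smul_eq_mul, mul_one]

theorem star_dotProduct_twirl_mulVec [Fintype H] {ρ : H →* Matrix.unitaryGroup n ℂ}
    {u v : n → ℂ} (hu : star u ⬝ᵥ u = 1) (hv : star v ⬝ᵥ v = 1) {χ ψ : H → ℂ}
    (hχ : ∀ h, (ρ h : Matrix n n ℂ) *ᵥ u = χ h • u)
    (hψ : ∀ h, (ρ h : Matrix n n ℂ) *ᵥ v = ψ h • v) [Decidable (χ = ψ)] (Y : Matrix n n ℂ) :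
    star u ⬝ᵥ ((Fintype.card H : ℂ)⁻¹ •
        ∑ h : H, (ρ h : Matrix n n ℂ) * Y * star (ρ h : Matrix n n ℂ)) *ᵥ v =
      if χ = ψ then star u ⬝ᵥ Y *ᵥ v else 0 := by
  let χ' := eigenCharacter ρ u hu χ hχ
  let ψ' := eigenCharacter ρ v hv ψ hψ
  have hterm (h : H) :
      star u ⬝ᵥ ((ρ h : Matrix n n ℂ) * Y * star (ρ h : Matrix n n ℂ)) *ᵥ v =
        χ h * ψ h⁻¹ * (star u ⬝ᵥ Y *ᵥ v) := by
    rw [star_dotProduct_mul_mul_mulVec, Matrix.star_eq_conjTranspose,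
      conjTranspose_map_eq_map_inv, hχ, hψ, star_smul, star_eigenvalue_eq_inv hu hχ, inv_inv,
      smul_dotProduct, Matrix.mulVec_smul, dotProduct_smul, smul_eq_mul, smul_eq_mul, mul_assoc]
  have hinv (h : H) : ψ h⁻¹ * ψ h = 1 := by
    change ψ' h⁻¹ * ψ' h = 1
    rw [← map_mul, inv_mul_cancel, map_one]
  rw [Matrix.smul_mulVec, dotProduct_smul, Matrix.sum_mulVec, dotProduct_sum,
    Finset.sum_congr rfl fun h _ => hterm h, ← Finset.sum_mul]
  split_ifs with heq
  · subst heq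
    have hsum : ∑ h, χ h * χ h⁻¹ = Fintype.card H := by
      rw [Finset.sum_congr rfl fun h _ => (mul_comm (χ h) (χ h⁻¹)).trans (hinv h)]
      simp
    rw [hsum, smul_eq_mul, inv_mul_cancel_left₀ (Nat.cast_ne_zero.mpr Fintype.card_ne_zero)]
  · let f : H →* ℂ := χ' * ψ'.comp (invMonoidHom : H →* H)
    have hf : f ≠ 1 := by
      intro hf
      refine heq (funext fun h => ?_)
      have h₁ : χ h * ψ h⁻¹ = 1 := DFunLike.congr_fun hf h
      calc χ h = χ h * (ψ h⁻¹ * ψ h) := by rw [hinv, mul_one]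
        _ = ψ h := by rw [← mul_assoc, h₁, one_mul]
    have hsum : ∑ h, χ h * ψ h⁻¹ = 0 := sum_hom_units_eq_zero f hf
    rw [hsum, zero_mul, smul_zero]

end Eigenvector

/-- Let `ρ : H → U(d)` be a unitary representation of a finite abelian
group `H` on `V = ℂ^d`, let `V = V₁ ⊕ ⋯ ⊕ V_m` be an orthogonal direct sum of
`ρ`-invariant subspaces with orthogonal projections `P k`, and let `(w_i)` be an adapted
orthonormal basis consisting of simultaneous eigenvectors, `ρ(h) w_i = χ_i(h) w_i`, with
distinct characters within each block (a non-degenerate commuting-subgroup eigenbasis).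
Then for every `X ∈ End(V)`,
`Σ_i ⟨w_i, X w_i⟩ |w_i⟩⟨w_i| = (1/|H|) Σ_{h∈H} ρ(h) P_D(X) ρ(h)*`
where `P_D(X) = Σ_k P k * X * P k` is the block-diagonal projection. -/
theorem dephasing_eq_twirl_comp_blockDiagonal
    (H : Type*) [CommGroup H] [Fintype H] (d m : ℕ)
    (ρ : H →* Matrix.unitaryGroup (Fin d) ℂ)
    -- the orthogonal projections onto the summands V_1, ..., V_m
    (P : Fin m → Matrix (Fin d) (Fin d) ℂ)
    (hPproj : ∀ k, P k * P k = P k)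
    (hPsa : ∀ k, (P k)ᴴ = P k)
    (hPorth : ∀ k l, k ≠ l → P k * P l = 0)
    (hPsum : ∑ k, P k = 1)
    -- each summand is ρ-invariant
    (hPinv : ∀ (h : H) k, (ρ h : Matrix (Fin d) (Fin d) ℂ) * P k
        = P k * (ρ h : Matrix (Fin d) (Fin d) ℂ))
    -- an orthonormal basis adapted to the decomposition
    (w : Fin d → Fin d → ℂ)
    (horth : ∀ i j, (∑ x, star (w i x) * w j x) = if i = j then 1 else 0)
    (k : Fin d → Fin m)
    (hadapt : ∀ i, (P (k i)).mulVec (w i) = w i)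
    -- simultaneous eigenvectors of H with characters χ_i,
    -- non-degenerate within each block
    (χ : Fin d → H → ℂ)
    (heig : ∀ (h : H) (i : Fin d),
      ((ρ h : Matrix (Fin d) (Fin d) ℂ)).mulVec (w i) = χ i h • w i)
    (hnd : ∀ i j, i ≠ j → k i = k j → χ i ≠ χ j)
    (X : Matrix (Fin d) (Fin d) ℂ) :
    ∑ i : Fin d,
        (∑ x, star (w i x) * (X.mulVec (w i)) x) •
          Matrix.vecMulVec (w i) (star (w i))
      = ((Fintype.card H : ℂ))⁻¹ •
          ∑ h : H, (ρ h : Matrix (Fin d) (Fin d) ℂ) * (∑ l, P l * X * P l) *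
            star (ρ h : Matrix (Fin d) (Fin d) ℂ) := by
  classical
  have hw : ∀ i j, star (w i) ⬝ᵥ w j = if i = j then 1 else 0 := horth
  have hunit (i : Fin d) : star (w i) ⬝ᵥ w i = 1 := by rw [hw, if_pos rfl]
  have hP (l : Fin m) (i : Fin d) : P l *ᵥ w i = if l = k i then w i else 0 := by
    split_ifs with h
    · rw [h, hadapt]
    · rw [← hadapt i, Matrix.mulVec_mulVec, hPorth l (k i) h, Matrix.zero_mulVec]
  refine eq_of_orthonormal_sesquilinear_eq hw fun i j => ?_
  rw [star_dotProduct_sum_vecMulVec_mulVec hw,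
    star_dotProduct_twirl_mulVec (hunit i) (hunit j) (fun h => heig h i) (fun h => heig h j),
    star_dotProduct_blockDiagonal_mulVec hPsa hP]
  by_cases hij : i = j
  · subst hij
    simp [dotProduct]
  · rw [if_neg hij]
    split_ifs with hχ hk
    · exact absurd hχ (hnd i j hij hk)
    all_goals rfl
end
end

section
/- Let W ⊆ End(V) be a subspace that is invariant and irreducible under the conjugation action X ↦ R(g) X R(g)* of G, and such that every element of W maps each summand V_k into itself. Then M maps W into itself and acts on W as the scalar a_W = dim(W^H)/dim(W): for all X ∈ W, M(X) = a_W · X, where W^H = {X ∈ W : R(h) X R(h)* = X for all h ∈ H}. (Any non-degenerate commuting-subgroup eigenbasis is centralizing, with visibility coefficients given by the ratio of the dimension of the H-invariant subspace to the dimension of the irrep.) -/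
open Matrix
open scoped BigOperators

noncomputable section

/-- Conjugation `X ↦ U X U*` as a linear endomorphism of `End(ℂ^d)`. -/
def conjMap {d : ℕ} (U : Matrix (Fin d) (Fin d) ℂ) :
    Matrix (Fin d) (Fin d) ℂ →ₗ[ℂ] Matrix (Fin d) (Fin d) ℂ :=
  (LinearMap.mulLeft ℂ U).comp (LinearMap.mulRight ℂ (star U))

/-- By Schur's lemma, averaging an endomorphism over an irreducible representation gives a scalar. -/
theorem Representation.IsIrreducible.inv_card_smul_sum_conj {K G V : Type*} [Field K]
    [IsAlgClosed K] [CharZero K] [Group G] [Fintype G] [AddCommGroup V] [Module K V]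
    [FiniteDimensional K V] (ρ : Representation K G V) [ρ.IsIrreducible] (T : V →ₗ[K] V) :
    (Fintype.card G : K)⁻¹ • ∑ g : G, ρ g⁻¹ * T * ρ g =
      (LinearMap.trace K V T / Module.finrank K V) • 1 := by
  have hcard : (Fintype.card G : K) ≠ 0 := by simp
  set S : V →ₗ[K] V := (Fintype.card G : K)⁻¹ • ∑ g : G, ρ g⁻¹ * T * ρ g with hS
  have hcomm (a : G) : S * ρ a = ρ a * S := by
    rw [hS, smul_mul_assoc, mul_smul_comm, Finset.sum_mul, Finset.mul_sum]
    congr 1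
    refine Fintype.sum_equiv (Equiv.mulRight a) _ _ fun g ↦ ?_
    simp only [Equiv.coe_mulRight, _root_.mul_inv_rev, map_mul, mul_assoc]
    rw [← mul_assoc (ρ a), ← map_mul ρ a, mul_inv_cancel, map_one, one_mul]
  let f : Representation.IntertwiningMap ρ ρ :=
    S.intertwiningMap_of_isIntertwiningMap ρ ρ
      fun g v ↦ LinearMap.congr_fun (hcomm g) v
  obtain ⟨c, hc⟩ :=
    (Representation.IsIrreducible.algebraMap_intertwiningMap_bijective_of_isAlgClosed
      (ρ := ρ)).2 f
  have hSc : S = c • 1 := by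
    ext v
    have := congrArg (fun F : Representation.IntertwiningMap ρ ρ ↦ F v) hc
    simpa [Algebra.algebraMap_eq_smul_one, f] using this.symm
  have htr : LinearMap.trace K V S = LinearMap.trace K V T := by
    have hconj (g : G) : LinearMap.trace K V (ρ g⁻¹ * T * ρ g) = LinearMap.trace K V T := by
      rw [LinearMap.trace_mul_comm, ← mul_assoc, ← map_mul, mul_inv_cancel, map_one, one_mul]
    simp [hS, map_sum, hconj, hcard]
  have : Nontrivial V := by
    by_contra h
    rw [not_nontrivial_iff_subsingleton] at h
    exact bot_ne_top (α := Subrepresentation ρ)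
      (Subrepresentation.toSubmodule_injective (Subsingleton.elim _ _))
  have hdim : (Module.finrank K V : K) ≠ 0 := by
    simpa using (Module.finrank_pos (R := K) (M := V)).ne'
  rw [← htr, hSc, map_smul, LinearMap.trace_one, smul_eq_mul, mul_div_cancel_right₀ _ hdim]

/-- The trace of the averaging projection is the dimension of the invariants. -/
theorem Representation.trace_averageMap {K G V : Type*} [Field K] [Group G] [Fintype G]
    [Invertible (Fintype.card G : K)] [AddCommGroup V] [Module K V] [FiniteDimensional K V]
    (ρ : Representation K G V) :
    LinearMap.trace K V ρ.averageMap = Module.finrank K ρ.invariants :=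
  ρ.isProj_averageMap.trace

/-- The sum of a nontrivial multiplicative function over a finite group vanishes. -/
theorem sum_eq_zero_of_map_mul {K G : Type*} [Field K] [Group G] [Fintype G] (f : G → K)
    (hmul : ∀ a b, f (a * b) = f a * f b) {a : G} (ha : f a ≠ 1) : ∑ g, f g = 0 := by
  have h : f a * ∑ g, f g = ∑ g, f g := by
    rw [Finset.mul_sum]
    exact Fintype.sum_equiv (Equiv.mulLeft a) _ _ fun g ↦ (hmul a g).symm
  exact (mul_left_eq_self₀.mp h).resolve_left ha

/-- Deletes the off-diagonal entries of `Y` in the orthonormal basis `w`. -/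
def dephase {d : ℕ} (w : Fin d → Fin d → ℂ) (Y : Matrix (Fin d) (Fin d) ℂ) :
    Matrix (Fin d) (Fin d) ℂ :=
  ∑ i, (∑ x, star (w i x) * (Y.mulVec (w i)) x) • Matrix.vecMulVec (w i) (star (w i))

theorem dephase_eq {d : ℕ} (w : Fin d → Fin d → ℂ) (Y : Matrix (Fin d) (Fin d) ℂ) :
    dephase w Y = (Matrix.of w)ᵀ *
      Matrix.diagonal (fun i ↦ (((Matrix.of w)ᵀ)ᴴ * Y * (Matrix.of w)ᵀ) i i) *
        ((Matrix.of w)ᵀ)ᴴ := by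
  have hdiag (i : Fin d) : (((Matrix.of w)ᵀ)ᴴ * Y * (Matrix.of w)ᵀ) i i =
      ∑ x, star (w i x) * (Y.mulVec (w i)) x := by
    rw [mul_assoc]
    rfl
  ext x y
  simp only [dephase, hdiag, Matrix.sum_apply, Matrix.smul_apply, Matrix.vecMulVec_apply,
    Matrix.mul_apply (N := ((Matrix.of w)ᵀ)ᴴ), Matrix.mul_diagonal, Matrix.conjTranspose_apply,
    Matrix.transpose_apply, Matrix.of_apply, Pi.star_apply, smul_eq_mul]
  exact Finset.sum_congr rfl fun i _ ↦ by ring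

/-- Conjugation by the values of a unitary representation. -/
def conjRep {G : Type*} [Group G] {d : ℕ} (R : G →* Matrix.unitaryGroup (Fin d) ℂ) :
    Representation ℂ G (Matrix (Fin d) (Fin d) ℂ) where
  toFun g := conjMap (R g : Matrix (Fin d) (Fin d) ℂ)
  map_one' := by ext1 X; simp [conjMap]
  map_mul' a b := by ext1 X; simp [conjMap, mul_assoc]

theorem conjRep_apply {G : Type*} [Group G] {d : ℕ} (R : G →* Matrix.unitaryGroup (Fin d) ℂ)
    (g : G) (X : Matrix (Fin d) (Fin d) ℂ) :
    conjRep R g X = (R g : Matrix (Fin d) (Fin d) ℂ) * X * star (R g : Matrix _ _ ℂ) := by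
  simp [conjRep, conjMap, mul_assoc]

theorem mChannel_eq {G : Type*} [Group G] [Fintype G] {d : ℕ}
    (R : G →* Matrix.unitaryGroup (Fin d) ℂ) (w : Fin d → Fin d → ℂ)
    (X : Matrix (Fin d) (Fin d) ℂ) :
    mChannel R w X =
      (Fintype.card G : ℂ)⁻¹ • ∑ g : G, conjRep R g⁻¹ (dephase w (conjRep R g X)) := by
  have hinv (g : G) : (R g⁻¹ : Matrix (Fin d) (Fin d) ℂ) = star (R g : Matrix _ _ ℂ) := by
    rw [map_inv]; rfl
  simp only [mChannel, dephase, map_sum, map_smul, conjRep_apply, hinv, star_star]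

/-- On operators whose matrix entries vanish wherever two eigencharacters coincide off the
diagonal, dephasing in the eigenbasis is averaging over the commuting subgroup. -/
theorem dephase_eq_average {H : Type*} [Group H] [Fintype H] {d : ℕ}
    (R : H →* Matrix.unitaryGroup (Fin d) ℂ) (w : Fin d → Fin d → ℂ)
    (horth : ∀ i j, (∑ x, star (w i x) * w j x) = if i = j then 1 else 0)
    (χ : Fin d → H → ℂ)
    (heig : ∀ h i, (R h : Matrix (Fin d) (Fin d) ℂ).mulVec (w i) = χ i h • w i)
    (Y : Matrix (Fin d) (Fin d) ℂ)
    (hY : ∀ i j, i ≠ j → χ i = χ j → ∑ x, star (w i x) * (Y.mulVec (w j)) x = 0) :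
    dephase w Y = (Fintype.card H : ℂ)⁻¹ • ∑ h : H, conjRep R h Y := by
  have hcard : (Fintype.card H : ℂ) ≠ 0 := by simp
  rw [dephase_eq]
  set U : Matrix (Fin d) (Fin d) ℂ := (Matrix.of w)ᵀ with hU
  have hUU : Uᴴ * U = 1 := by
    ext i j
    rw [Matrix.one_apply, ← horth]
    rfl
  have hUU' : U * Uᴴ = 1 := mul_eq_one_comm.mp hUU
  set Z := Uᴴ * Y * U with hZ
  have hYZ : Y = U * Z * Uᴴ := by
    calc Y = (U * Uᴴ) * Y * (U * Uᴴ) := by simp [hUU']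
      _ = _ := by simp only [hZ, mul_assoc]
  have hRU (h : H) : (R h : Matrix (Fin d) (Fin d) ℂ) * U =
      U * Matrix.diagonal fun i ↦ χ i h := by
    ext x i
    rw [Matrix.mul_diagonal, mul_comm]
    exact congrFun (heig h i) x
  have hUR (h : H) : Uᴴ * star (R h : Matrix (Fin d) (Fin d) ℂ) =
      Matrix.diagonal (fun i ↦ star (χ i h)) * Uᴴ := by
    have := congrArg Matrix.conjTranspose (hRU h)
    rwa [Matrix.conjTranspose_mul, Matrix.conjTranspose_mul,
      Matrix.diagonal_conjTranspose] at this
  have hdiagR (h : H) : Matrix.diagonal (fun i ↦ χ i h) =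
      Uᴴ * (R h : Matrix (Fin d) (Fin d) ℂ) * U := by
    rw [mul_assoc, hRU, ← mul_assoc, hUU, one_mul]
  have hχmul (i : Fin d) (a b : H) : χ i (a * b) = χ i a * χ i b := by
    have : Matrix.diagonal (fun i ↦ χ i (a * b)) =
        Matrix.diagonal (fun i ↦ χ i a) * Matrix.diagonal (fun i ↦ χ i b) := by
      rw [hdiagR, map_mul, Submonoid.coe_mul, mul_assoc, mul_assoc, hRU, ← mul_assoc _ U, hRU,
        mul_assoc, ← mul_assoc, hUU, one_mul]
    simpa using congrFun (congrFun this i) i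
  have hχstar (i : Fin d) (h : H) : χ i h * star (χ i h) = 1 := by
    have : Matrix.diagonal (fun i ↦ χ i h) * Matrix.diagonal (fun i ↦ star (χ i h)) = 1 := by
      calc _ = Uᴴ * ((U * Matrix.diagonal fun i ↦ χ i h) *
            (Matrix.diagonal (fun i ↦ star (χ i h)) * Uᴴ)) * U := by
            simp only [← mul_assoc, hUU, one_mul]
            simp only [mul_assoc, hUU, mul_one]
        _ = Uᴴ * ((R h : Matrix (Fin d) (Fin d) ℂ) * (U * Uᴴ) * star (R h : Matrix _ _ ℂ)) * U := by
            rw [← hRU, ← hUR]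
            simp only [mul_assoc]
        _ = 1 := by
            rw [hUU', mul_one, Unitary.mul_star_self_of_mem (R h).2, mul_one, hUU]
    simpa using congrFun (congrFun this i) i
  have hent (i j : Fin d) :
      Z i j * ∑ h, χ i h * star (χ j h) =
        Fintype.card H * Matrix.diagonal (fun i ↦ Z i i) i j := by
    by_cases hij : i = j
    · subst hij
      simp only [hχstar, Matrix.diagonal_apply_eq, Finset.sum_const, Finset.card_univ,
        nsmul_eq_mul, mul_one, mul_comm]
    · rw [Matrix.diagonal_apply_ne _ hij, mul_zero]
      by_cases hχ : χ i = χ j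
      · have : Z i j = 0 := by
          rw [← hY i j hij hχ, hZ, mul_assoc]
          rfl
        rw [this, zero_mul]
      · obtain ⟨a, ha⟩ := Function.ne_iff.mp hχ
        rw [sum_eq_zero_of_map_mul (fun h ↦ χ i h * star (χ j h)) (a := a), mul_zero]
        · intro a b
          simp only [hχmul, star_mul']
          ring
        · intro h1
          apply ha
          calc χ i a = χ i a * star (χ j a) * χ j a := by
                rw [mul_assoc, mul_comm (star _), hχstar, mul_one]
            _ = χ j a := by rw [h1, one_mul]
  have hconj (h : H) : conjRep R h Y =
      U * (Matrix.diagonal (fun i ↦ χ i h) * Z * Matrix.diagonal (fun i ↦ star (χ i h))) * Uᴴ := by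
    rw [conjRep_apply, hYZ]
    calc _ = ((R h : Matrix (Fin d) (Fin d) ℂ) * U) * Z * (Uᴴ * star (R h : Matrix _ _ ℂ)) := by
          simp only [mul_assoc]
      _ = _ := by rw [hRU, hUR]; simp only [mul_assoc]
  simp only [hconj]
  rw [← Finset.sum_mul, ← Finset.mul_sum, ← smul_mul_assoc, ← mul_smul_comm]
  congr 2
  ext i j
  rw [Matrix.smul_apply, Matrix.sum_apply, smul_eq_mul, eq_inv_mul_iff_mul_eq₀ hcard, ← hent,
    Finset.mul_sum]
  refine Finset.sum_congr rfl fun h _ ↦ ?_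
  rw [Matrix.mul_diagonal, Matrix.diagonal_mul]
  ring

/-- A block-preserving operator has no matrix entries between vectors of different blocks. -/
theorem sum_star_mul_mulVec_eq_zero {n : Type*} [Fintype n] {P Q Y : Matrix n n ℂ}
    {u v : n → ℂ} (hP : Pᴴ = P) (hPQ : P * Q = 0) (hu : P.mulVec u = u) (hv : Q.mulVec v = v)
    (hY : Q * Y * Q = Y * Q) : ∑ x, star (u x) * (Y.mulVec v) x = 0 := by
  change star u ⬝ᵥ Y.mulVec v = 0
  rw [← hu, ← hv, Matrix.mulVec_mulVec, ← hY, Matrix.star_mulVec, hP,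
    ← Matrix.dotProduct_mulVec, Matrix.mulVec_mulVec, ← mul_assoc, ← mul_assoc, hPQ]
  simp

/-- In the NDCSE setting (unitary representation `R` of a finite group
`G` on `ℂ^d`, orthogonal decomposition into irreducible invariant summands with
projections `P k`, adapted orthonormal basis `w` of simultaneous eigenvectors of an
abelian subgroup `H ≤ G` with characters non-degenerate within each block), let
`W ⊆ End(V)` be a subspace invariant and irreducible under conjugation by the
representation, whose elements map each summand into itself.  Then the measurement
channel acts on `W` as the scalar `a_W = dim(W^H)/dim(W)`, where `W^H` is the subspace
of `W` fixed by conjugation by `R(h)` for all `h ∈ H`. -/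
theorem ndcse_is_centralizing
    (G : Type*) [Group G] [Fintype G] (d m : ℕ)
    (R : G →* Matrix.unitaryGroup (Fin d) ℂ)
    -- the orthogonal projections onto the summands V_1, ..., V_m
    (P : Fin m → Matrix (Fin d) (Fin d) ℂ)
    (hPproj : ∀ k, P k * P k = P k)
    (hPsa : ∀ k, (P k)ᴴ = P k)
    (hPorth : ∀ k l, k ≠ l → P k * P l = 0)
    (hPsum : ∑ k, P k = 1)
    (hPinv : ∀ (g : G) k, (R g : Matrix (Fin d) (Fin d) ℂ) * P k
        = P k * (R g : Matrix (Fin d) (Fin d) ℂ))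
    -- each summand is irreducible as a G-module
    (hirr : ∀ k (Q : Matrix (Fin d) (Fin d) ℂ), Q * Q = Q → Qᴴ = Q →
        Q * P k = Q → P k * Q = Q →
        (∀ g : G, (R g : Matrix (Fin d) (Fin d) ℂ) * Q
          = Q * (R g : Matrix (Fin d) (Fin d) ℂ)) →
        Q = 0 ∨ Q = P k)
    -- an orthonormal basis adapted to the decomposition
    (w : Fin d → Fin d → ℂ)
    (horth : ∀ i j, (∑ x, star (w i x) * w j x) = if i = j then 1 else 0)
    (k : Fin d → Fin m)
    (hadapt : ∀ i, (P (k i)).mulVec (w i) = w i)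
    -- an abelian subgroup H of G for which w is a non-degenerate simultaneous eigenbasis
    (H : Subgroup G)
    (hHab : ∀ a b : H, a * b = b * a)
    (χ : Fin d → H → ℂ)
    (heig : ∀ (h : H) (i : Fin d),
      ((R (h : G) : Matrix (Fin d) (Fin d) ℂ)).mulVec (w i) = χ i h • w i)
    (hnd : ∀ i j, i ≠ j → k i = k j → χ i ≠ χ j)
    -- the operator subspace W: conjugation-invariant, irreducible, block-preserving
    (W : Submodule ℂ (Matrix (Fin d) (Fin d) ℂ))
    (hWinv : ∀ (g : G), ∀ X ∈ W, conjMap (R g : Matrix (Fin d) (Fin d) ℂ) X ∈ W)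
    (hWirr : ∀ W' : Submodule ℂ (Matrix (Fin d) (Fin d) ℂ), W' ≤ W →
      (∀ (g : G), ∀ X ∈ W', conjMap (R g : Matrix (Fin d) (Fin d) ℂ) X ∈ W') →
      W' = ⊥ ∨ W' = W)
    (hWdiag : ∀ X ∈ W, ∀ l, P l * X * P l = X * P l) :
    ∀ X ∈ W, mChannel R w X =
      (((Module.finrank ℂ
          ↥(W ⊓ ⨅ h : H, LinearMap.ker
              (conjMap ((R (h : G) : Matrix (Fin d) (Fin d) ℂ)) - LinearMap.id)) : ℂ)) /
        ((Module.finrank ℂ ↥W : ℂ))) • X := by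
  classical
  have : Fintype H := Fintype.ofFinite H
  intro X hX
  rcases eq_or_ne W ⊥ with hW | hW
  · obtain rfl : X = 0 := by simpa [hW] using hX
    simp [mChannel]
  let σ : Representation ℂ G W := (conjRep R).subrepresentation W hWinv
  have hσ (g : G) (Y : W) : (σ g Y : Matrix (Fin d) (Fin d) ℂ) = conjRep R g Y := rfl
  have hσirr : σ.IsIrreducible :=
    { exists_pair_ne := by
        refine ⟨⊥, ⊤, fun h ↦ hW ((Submodule.eq_bot_iff _).mpr fun Y hY ↦ ?_)⟩
        have : (⟨Y, hY⟩ : W) ∈ (⊥ : Subrepresentation σ) := h ▸ trivial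
        exact congrArg Subtype.val (show (⟨Y, hY⟩ : W) = 0 from this)
      eq_bot_or_eq_top := fun S ↦ by
        rcases hWirr (S.toSubmodule.map W.subtype) (Submodule.map_subtype_le _ _) (by
          rintro g _ ⟨Y, hY, rfl⟩
          exact ⟨σ g Y, S.apply_mem_toSubmodule g hY, rfl⟩) with h | h
        · left
          apply Subrepresentation.toSubmodule_injective
          apply Submodule.map_injective_of_injective W.injective_subtype
          rw [h]
          exact (Submodule.map_bot W.subtype).symm
        · right
          apply Subrepresentation.toSubmodule_injective
          apply Submodule.map_injective_of_injective W.injective_subtype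
          rw [h]
          exact (Submodule.map_subtype_top W).symm }
  let τ : Representation ℂ H W := σ.comp H.subtype
  have : Invertible (Fintype.card H : ℂ) := invertibleOfNonzero (by simp)
  have hτ (Y : W) : dephase w Y = (τ.averageMap Y : Matrix (Fin d) (Fin d) ℂ) := by
    rw [dephase_eq_average (R.comp H.subtype) w horth χ heig Y]
    · simp [GroupAlgebra.average, τ, hσ, conjRep]
    · intro i j hij hχ
      exact sum_star_mul_mulVec_eq_zero (hPsa _)
        (hPorth _ _ fun hk ↦ hnd i j hij hk hχ) (hadapt i) (hadapt j) (hWdiag Y Y.2 _)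
  have hM := LinearMap.congr_fun
    (Representation.IsIrreducible.inv_card_smul_sum_conj σ τ.averageMap) ⟨X, hX⟩
  rw [τ.trace_averageMap] at hM
  have hinv : τ.invariants.map W.subtype = W ⊓ ⨅ h : H, LinearMap.ker
      (conjMap ((R (h : G) : Matrix (Fin d) (Fin d) ℂ)) - LinearMap.id) := by
    ext Y
    simp only [Submodule.mem_map, Submodule.mem_inf, Submodule.mem_iInf, LinearMap.mem_ker,
      LinearMap.sub_apply, LinearMap.id_apply, sub_eq_zero]
    constructor
    · rintro ⟨Y, hY, rfl⟩
      exact ⟨Y.2, fun h ↦ congrArg Subtype.val (hY h)⟩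
    · rintro ⟨hY, h⟩
      exact ⟨⟨Y, hY⟩, fun a ↦ Subtype.ext (h a), rfl⟩
  have hrank : Module.finrank ℂ ↥(W ⊓ ⨅ h : H, LinearMap.ker
      (conjMap ((R (h : G) : Matrix (Fin d) (Fin d) ℂ)) - LinearMap.id)) =
      Module.finrank ℂ τ.invariants := by
    rw [← hinv]
    exact Submodule.finrank_map_subtype_eq W τ.invariants
  rw [hrank, mChannel_eq]
  have hM' := congrArg Subtype.val hM
  simp only [LinearMap.smul_apply, LinearMap.sum_apply, Module.End.mul_apply, Submodule.coe_smul,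
    Submodule.coe_sum, hσ, Module.End.one_apply, ← hτ] at hM'
  exact hM'
end
end

section
/- For every natural number m ≥ 5, 3^{2m} < (C_m)³, where C_m = (2m)! / (m! · (m+1)!) is the m-th Catalan number. (Equivalently, C_m > 3^{2m/3}; this is the growth estimate showing the dimension of the two-row symmetric-group irrep (m,m) eventually exceeds the maximal order 3^{n/3} of an abelian subgroup of S_n with n = 2m.) -/
theorem catalan_eq_factorial_div (m : ℕ) :
    catalan m = (2 * m).factorial / (m.factorial * (m + 1).factorial) := by
  refine (Nat.div_eq_of_eq_mul_left (by positivity) ?_).symm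
  have h := Nat.choose_mul_factorial_mul_factorial (show m ≤ 2 * m by omega)
  rw [← Nat.centralBinom_eq_two_mul_choose, ← succ_mul_catalan_eq_centralBinom,
    show 2 * m - m = m by omega] at h
  rw [← h, Nat.factorial_succ]
  ring

theorem add_two_mul_catalan_succ (m : ℕ) :
    (m + 2) * catalan (m + 1) = 2 * (2 * m + 1) * catalan m := by
  have h := Nat.succ_mul_centralBinom_succ m
  rw [← succ_mul_catalan_eq_centralBinom, ← succ_mul_catalan_eq_centralBinom] at h
  refine Nat.eq_of_mul_eq_mul_left (Nat.add_pos_right m one_pos) ?_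
  linear_combination h

theorem three_mul_catalan_le_catalan_succ {m : ℕ} (hm : 4 ≤ m) :
    3 * catalan m ≤ catalan (m + 1) := by
  refine Nat.le_of_mul_le_mul_left ?_ (Nat.succ_pos (m + 1))
  calc (m + 2) * (3 * catalan m) = (m + 2) * 3 * catalan m := by ring
    _ ≤ 2 * (2 * m + 1) * catalan m := Nat.mul_le_mul_right _ (by omega)
    _ = (m + 2) * catalan (m + 1) := (add_two_mul_catalan_succ m).symm

/-- For every natural number `m ≥ 5`, `3^(2m) < (C_m)³`, where
`C_m = (2m)! / (m! · (m+1)!)` is the `m`-th Catalan number. -/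
theorem three_pow_lt_catalan_cube (m : ℕ) (hm : 5 ≤ m) :
    3 ^ (2 * m) < ((2 * m).factorial / (m.factorial * (m + 1).factorial)) ^ 3 := by
  rw [← catalan_eq_factorial_div]
  induction m, hm using Nat.le_induction with
  | base =>
    rw [catalan_eq_factorial_div]
    norm_num [Nat.factorial]
  | succ k hk ih =>
    calc 3 ^ (2 * (k + 1)) = 9 * 3 ^ (2 * k) := by ring
      _ < 27 * catalan k ^ 3 := by omega
      _ = (3 * catalan k) ^ 3 := by ring
      _ ≤ catalan (k + 1) ^ 3 :=
        Nat.pow_le_pow_left (three_mul_catalan_le_catalan_succ (by omega)) 3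
end

section
/- For all natural numbers n and j with 1 ≤ j and 2j ≤ n: binom(n, j) · (binom(n, j) + binom(n, j−1)) ≤ binom(2n, 2j). (Equivalently, the particle-number-preserving free-fermion shadow visibility coefficient 1/(binom(n,j) + binom(n,j−1)) is at least the full fermionic-Gaussian coefficient binom(n,j)/binom(2n,2j).) -/
/-- Doubling the next binomial coefficient compensates for any decrease below the middle. -/
lemma choose_le_two_mul_choose_succ {n j : ℕ} (h1 : 1 ≤ j) (h2 : 2 * j ≤ n) :
    n.choose j ≤ 2 * n.choose (j + 1) := by
  have h := Nat.choose_succ_right_eq n j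
  have hj : j ≤ n - j := by omega
  have hle : n.choose j * j ≤ n.choose (j + 1) * (j + 1) := h ▸ Nat.mul_le_mul_left _ hj
  have hj' : n.choose (j + 1) * (j + 1) ≤ n.choose (j + 1) * (2 * j) :=
    Nat.mul_le_mul_left _ (by omega)
  refine Nat.le_of_mul_le_mul_right (c := j) ?_ h1
  linarith

/-- The three central terms of Vandermonde's identity bound `binom(2n, 2(k+1))` from below. -/
lemma central_vandermonde_terms_le (n k : ℕ) :
    n.choose (k + 1) * n.choose (k + 1) + 2 * (n.choose k * n.choose (k + 2)) ≤
      (2 * n).choose (2 * (k + 1)) := by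
  have hsub : ({(k + 1, k + 1), (k, k + 2), (k + 2, k)} : Finset (ℕ × ℕ)) ⊆
      Finset.HasAntidiagonal.antidiagonal (2 * (k + 1)) := by
    intro p hp
    simp only [Finset.mem_insert, Finset.mem_singleton] at hp
    rw [Finset.HasAntidiagonal.mem_antidiagonal]
    rcases hp with rfl | rfl | rfl <;> dsimp only <;> omega
  rw [two_mul n, Nat.add_choose_eq]
  refine le_trans (le_of_eq ?_) (Finset.sum_le_sum_of_subset hsub)
  rw [Finset.sum_insert (by simp), Finset.sum_insert (by simp), Finset.sum_singleton]
  ring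

/-- For all natural numbers `n`, `j` with `1 ≤ j` and `2j ≤ n`,
`binom(n,j) · (binom(n,j) + binom(n,j−1)) ≤ binom(2n, 2j)`. -/
theorem choose_product_le_central_choose (n j : ℕ) (h1 : 1 ≤ j) (h2 : 2 * j ≤ n) :
    n.choose j * (n.choose j + n.choose (j - 1)) ≤ (2 * n).choose (2 * j) := by
  have hstep := choose_le_two_mul_choose_succ h1 h2
  obtain ⟨k, rfl⟩ := Nat.exists_eq_add_of_le' h1
  rw [Nat.add_sub_cancel]
  refine le_trans ?_ (central_vandermonde_terms_le n k)
  have := Nat.mul_le_mul_left (n.choose k) hstep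
  linarith
end

section
/- For all natural numbers n and j with 1 ≤ j and 2j ≤ n, the number of standard Young tableaux of shape (2^j, 1^{n−2j}) — the Young diagram with j rows of length 2 followed by n − 2j rows of length 1, filled bijectively with the numbers 1, …, n so that entries strictly increase along each row and down each column — equals binom(n, j) − binom(n, j−1). -/
/-- The set of cells of the Young diagram `(2^j, 1^{n−2j})`: rows `0, …, j−1` have the
two cells `(r,0)`, `(r,1)`, and rows `j, …, n−j−1` have the single cell `(r,0)`.
A cell is encoded as a pair `(r, c) : Fin n × Fin 2`. -/
def hookShapeCell (n j : ℕ) (rc : Fin n × Fin 2) : Prop :=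
  (rc.2 = (0 : Fin 2) ∧ (rc.1 : ℕ) < n - j) ∨ (rc.2 = (1 : Fin 2) ∧ (rc.1 : ℕ) < j)

instance (n j : ℕ) : DecidablePred (hookShapeCell n j) := fun rc => by
  unfold hookShapeCell; infer_instance

/-- A standard Young tableau of shape `(2^j, 1^{n−2j})`: a bijective filling of the
cells of the diagram with the `n` values of `Fin n` whose entries strictly increase
along every row and down every column. -/
def HookShapeSYT (n j : ℕ) : Type :=
  { f : {rc : Fin n × Fin 2 // hookShapeCell n j rc} → Fin n //
    Function.Bijective f ∧
    -- entries strictly increase along each row (left to right)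
    (∀ a b : {rc : Fin n × Fin 2 // hookShapeCell n j rc},
      a.1.1 = b.1.1 → a.1.2 < b.1.2 → f a < f b) ∧
    -- entries strictly increase down each column (top to bottom)
    (∀ a b : {rc : Fin n × Fin 2 // hookShapeCell n j rc},
      a.1.2 = b.1.2 → a.1.1 < b.1.1 → f a < f b) }

open Finset

/-- Every initial segment `{0, …, k-1}` contains at least as many non-elements of `S`
as elements of `S`. -/
def IsBallot (S : Finset ℕ) : Prop := ∀ k, 2 * #{x ∈ S | x < k} ≤ k

open scoped Classical in
/-- The ballot subsets of `{0, …, n-1}` with `j` elements. -/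
noncomputable def ballotSets (n j : ℕ) : Finset (Finset ℕ) :=
  {S ∈ powersetCard j (range n) | IsBallot S}

theorem mem_ballotSets {n j : ℕ} {S : Finset ℕ} :
    S ∈ ballotSets n j ↔ (S ⊆ range n ∧ #S = j) ∧ IsBallot S := by
  simp [ballotSets, mem_powersetCard]

theorem ballotSets_zero_right (n : ℕ) : ballotSets n 0 = {∅} := by
  ext S
  simp only [mem_ballotSets, card_eq_zero, mem_singleton]
  constructor
  · exact fun h => h.1.2
  · rintro rfl
    simp [IsBallot]

theorem ballotSets_eq_empty {n j : ℕ} (h : n < 2 * j) : ballotSets n j = ∅ := by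
  refine eq_empty_of_forall_notMem fun S hS => ?_
  obtain ⟨⟨hS, hc⟩, hb⟩ := mem_ballotSets.1 hS
  have := hb n
  rw [filter_true_of_mem fun x hx => mem_range.1 (hS hx), hc] at this
  omega

theorem isBallot_insert_iff {n j : ℕ} (h : 2 * (j + 1) ≤ n + 1) {S : Finset ℕ}
    (hc : #S = j) : IsBallot (insert n S) ↔ IsBallot S := by
  refine ⟨fun hb k => (Nat.mul_le_mul_left 2 (card_le_card ?_)).trans (hb k), fun hb k => ?_⟩
  · exact filter_subset_filter _ (subset_insert _ _)
  · rcases le_or_gt k n with hk | hk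
    · rw [filter_insert, if_neg (by omega)]
      exact hb k
    · have h1 := card_le_card (filter_subset (· < k) (insert n S))
      have h2 := card_insert_le n S
      omega

theorem card_ballotSets_succ {n j : ℕ} (h : 2 * (j + 1) ≤ n + 1) :
    #(ballotSets (n + 1) (j + 1)) = #(ballotSets n (j + 1)) + #(ballotSets n j) := by
  classical
  have hinj : Set.InjOn (insert n) (ballotSets n j : Set (Finset ℕ)) := by
    intro S hS T hT hST
    have hS' : n ∉ S := fun hn => by
      simpa using (mem_ballotSets.1 (mem_coe.1 hS)).1.1 hn
    have hT' : n ∉ T := fun hn => by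
      simpa using (mem_ballotSets.1 (mem_coe.1 hT)).1.1 hn
    rw [← erase_insert hS', ← erase_insert hT']
    exact congrArg (fun U => U.erase n) hST
  rw [← card_image_of_injOn hinj, ← card_union_of_disjoint]
  · congr 1
    ext S
    simp only [mem_union, mem_image]
    conv_lhs => rw [ballotSets, range_add_one, mem_filter,
      powersetCard_succ_insert notMem_range_self, mem_union, mem_image]
    simp only [mem_powersetCard]
    constructor
    · rintro ⟨hS | ⟨T, hT, rfl⟩, hb⟩
      · exact Or.inl (mem_ballotSets.2 ⟨hS, hb⟩)
      · exact Or.inr ⟨T, mem_ballotSets.2 ⟨hT, (isBallot_insert_iff h hT.2).1 hb⟩, rfl⟩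
    · rintro (hS | ⟨T, hT, rfl⟩)
      · exact ⟨Or.inl (mem_ballotSets.1 hS).1, (mem_ballotSets.1 hS).2⟩
      · obtain ⟨hT, hb⟩ := mem_ballotSets.1 hT
        exact ⟨Or.inr ⟨T, hT, rfl⟩, (isBallot_insert_iff h hT.2).2 hb⟩
  · refine disjoint_left.2 fun S hS hS' => ?_
    obtain ⟨T, -, rfl⟩ := mem_image.1 hS'
    simpa using (mem_ballotSets.1 hS).1.1 (mem_insert_self n T)

theorem card_ballotSets_add_choose (n j : ℕ) (h : 2 * (j + 1) ≤ n + 1) :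
    #(ballotSets n (j + 1)) + n.choose j = n.choose (j + 1) := by
  induction n generalizing j with
  | zero => omega
  | succ n ih =>
    rcases Nat.lt_or_ge (n + 1) (2 * (j + 1)) with hn | hn
    · rw [ballotSets_eq_empty hn, card_empty, zero_add]
      exact Nat.choose_symm_of_eq_add (by omega)
    · have h1 := ih j hn
      rw [card_ballotSets_succ hn, Nat.choose_succ_succ' n j]
      cases j with
      | zero =>
        rw [ballotSets_zero_right, card_singleton]
        simp only [Nat.choose_zero_right] at h1 ⊢
        omega
      | succ j =>
        have h2 := ih j (by omega)
        rw [Nat.choose_succ_succ' n j]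
        omega

/-- If `u` and `v` enumerate increasingly a partition of `{0, …, n-1}`, then the image of `v`
is ballot exactly when `u` is pointwise smaller than `v`. -/
theorem isBallot_image_iff {n m j : ℕ} (hjm : j ≤ m) {u : Fin m → ℕ} {v : Fin j → ℕ}
    (hu : StrictMono u) (hv : StrictMono v) (hd : ∀ i i', u i ≠ v i')
    (hn : ∀ x, x < n ↔ (∃ i, u i = x) ∨ ∃ i, v i = x) :
    IsBallot (univ.image v) ↔ ∀ i : Fin j, u (i.castLE hjm) < v i := by
  constructor
  · intro hb r
    by_contra! hlt
    have hlt : v r < u (r.castLE hjm) := lt_of_le_of_ne hlt (hd _ _).symm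
    have h1 : (r : ℕ) + 1 ≤ #{x ∈ univ.image v | x < v r + 1} := by
      rw [← Fin.card_Iic, ← card_image_of_injective _ hv.injective]
      refine card_le_card fun x hx => ?_
      obtain ⟨i, hi, rfl⟩ := mem_image.1 hx
      have := hv.monotone (mem_Iic.1 hi)
      simp only [mem_filter, mem_image, mem_univ, true_and]
      exact ⟨⟨i, rfl⟩, by omega⟩
    have h2 : #{x ∈ range (v r + 1) | ¬ x ∈ univ.image v} ≤ r := by
      have hr : #(Iio (r.castLE hjm)) = r := by simp
      rw [← hr, ← card_image_of_injective _ hu.injective]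
      refine card_le_card fun x hx => ?_
      simp only [mem_filter, mem_range, mem_image, mem_univ, true_and] at hx
      have hvr := (hn (v r)).2 (Or.inr ⟨r, rfl⟩)
      obtain ⟨i, rfl⟩ := ((hn x).1 (by omega)).resolve_right hx.2
      exact mem_image_of_mem _ (mem_Iio.2 (hu.lt_iff_lt.1 (by omega)))
    have h3 := card_filter_add_card_filter_not (s := range (v r + 1)) (· ∈ univ.image v)
    have h4 : {x ∈ range (v r + 1) | x ∈ univ.image v} = {x ∈ univ.image v | x < v r + 1} := by
      ext x
      simp only [mem_filter, mem_range, and_comm]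
    rw [h4, card_range] at h3
    have := hb (v r + 1)
    omega
  · intro h k
    set A : Finset (Fin j) := {i | v i < k} with hA
    have h1 : {x ∈ univ.image v | x < k} = A.image v := by
      rw [filter_image]
    have h2 : #(A.image fun i => u (i.castLE hjm)) = #A :=
      card_image_of_injective _ (hu.injective.comp (Fin.castLE_injective hjm))
    have h3 : Disjoint (A.image v) (A.image fun i => u (i.castLE hjm)) := by
      refine disjoint_left.2 fun x hx hx' => ?_
      obtain ⟨i, -, rfl⟩ := mem_image.1 hx
      obtain ⟨i', -, h'⟩ := mem_image.1 hx'
      exact hd _ _ h'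
    have h4 : A.image v ∪ (A.image fun i => u (i.castLE hjm)) ⊆ range k := by
      refine union_subset (image_subset_iff.2 fun i hi => ?_) (image_subset_iff.2 fun i hi => ?_)
      · simpa [hA] using hi
      · have : v i < k := by simpa [hA] using hi
        exact mem_range.2 ((h i).trans this)
    have h5 := card_le_card h4
    rw [card_union_of_disjoint h3, h2, card_range, card_image_of_injective _ hv.injective] at h5
    rw [h1, card_image_of_injective _ hv.injective]
    omega

namespace HookShapeSYT

variable {n j : ℕ}

/-- The cell in row `i` of the first column. -/
def leftCell (i : Fin (n - j)) : {rc : Fin n × Fin 2 // hookShapeCell n j rc} :=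
  ⟨(⟨i, by omega⟩, 0), Or.inl ⟨rfl, i.2⟩⟩

/-- The cell in row `i` of the second column. -/
def rightCell (hj : j ≤ n) (i : Fin j) : {rc : Fin n × Fin 2 // hookShapeCell n j rc} :=
  ⟨(⟨i, by omega⟩, 1), Or.inr ⟨rfl, i.2⟩⟩

theorem cell_cases (hj : j ≤ n) (a : {rc : Fin n × Fin 2 // hookShapeCell n j rc}) :
    (∃ i, a = leftCell i) ∨ ∃ i, a = rightCell hj i := by
  obtain ⟨⟨r, c⟩, ⟨h, hr⟩ | ⟨h, hr⟩⟩ := a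
  · obtain rfl : c = 0 := h
    exact Or.inl ⟨⟨r, hr⟩, rfl⟩
  · obtain rfl : c = 1 := h
    exact Or.inr ⟨⟨r, hr⟩, rfl⟩

theorem leftCell_ne_rightCell (hj : j ≤ n) (i : Fin (n - j)) (i' : Fin j) :
    leftCell i ≠ rightCell hj i' := fun h => by
  simpa [leftCell, rightCell] using congrArg (fun a => a.1.2) h

/-- The entries of the first column. -/
def left (f : HookShapeSYT n j) (i : Fin (n - j)) : ℕ := f.1 (leftCell i)

/-- The entries of the second column. -/
def right (hj : j ≤ n) (f : HookShapeSYT n j) (i : Fin j) : ℕ := f.1 (rightCell hj i)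

theorem strictMono_left (f : HookShapeSYT n j) : StrictMono f.left :=
  fun _ _ h => f.2.2.2 _ _ rfl h

theorem strictMono_right (hj : j ≤ n) (f : HookShapeSYT n j) : StrictMono (f.right hj) :=
  fun _ _ h => f.2.2.2 _ _ rfl h

theorem left_ne_right (hj : j ≤ n) (f : HookShapeSYT n j) (i : Fin (n - j)) (i' : Fin j) :
    f.left i ≠ f.right hj i' :=
  fun h => leftCell_ne_rightCell hj i i' (f.2.1.1 (Fin.ext h))

theorem lt_iff_left_or_right (hj : j ≤ n) (f : HookShapeSYT n j) (x : ℕ) :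
    x < n ↔ (∃ i, f.left i = x) ∨ ∃ i, f.right hj i = x := by
  constructor
  · intro hx
    obtain ⟨a, ha⟩ := f.2.1.2 ⟨x, hx⟩
    have hx : (f.1 a : ℕ) = x := congrArg Fin.val ha
    rcases cell_cases hj a with ⟨i, rfl⟩ | ⟨i, rfl⟩
    · exact Or.inl ⟨i, hx⟩
    · exact Or.inr ⟨i, hx⟩
  · rintro (⟨i, rfl⟩ | ⟨i, rfl⟩)
    · exact (f.1 _).2
    · exact (f.1 _).2

theorem ext_columns (hj : j ≤ n) {f g : HookShapeSYT n j} (hl : f.left = g.left)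
    (hr : f.right hj = g.right hj) : f = g := by
  refine Subtype.ext (funext fun a => Fin.ext ?_)
  rcases cell_cases hj a with ⟨i, rfl⟩ | ⟨i, rfl⟩
  · exact congrFun hl i
  · exact congrFun hr i

/-- The set of entries of the second column. -/
def rightSet (hj : j ≤ n) (f : HookShapeSYT n j) : Finset ℕ := univ.image (f.right hj)

theorem rightSet_mem_ballotSets (hj : j ≤ n) (hjm : j ≤ n - j) (f : HookShapeSYT n j) :
    f.rightSet hj ∈ ballotSets n j := by
  refine mem_ballotSets.2 ⟨⟨image_subset_iff.2 fun i _ => mem_range.2 (f.1 _).2, ?_⟩, ?_⟩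
  · rw [rightSet, card_image_of_injective _ (f.strictMono_right hj).injective, card_fin]
  · refine (isBallot_image_iff hjm f.strictMono_left (f.strictMono_right hj)
      (f.left_ne_right hj) (f.lt_iff_left_or_right hj)).2 fun i => ?_
    exact f.2.2.1 (leftCell (i.castLE hjm)) (rightCell hj i) rfl Fin.zero_lt_one

theorem rightSet_injective (hj : j ≤ n) :
    Function.Injective (rightSet hj : HookShapeSYT n j → Finset ℕ) := by
  intro f g hfg
  have hr : f.right hj = g.right hj := by
    refine ((f.strictMono_right hj).range_inj (g.strictMono_right hj)).1 ?_
    simpa [rightSet] using congrArg (fun S : Finset ℕ => (S : Set ℕ)) hfg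
  refine ext_columns hj ((f.strictMono_left.range_inj g.strictMono_left).1 ?_) hr
  have key (f : HookShapeSYT n j) :
      Set.range f.left = {x | x < n ∧ ¬ ∃ i, f.right hj i = x} := by
    ext x
    rw [Set.mem_ofPred_eq, f.lt_iff_left_or_right hj]
    constructor
    · rintro ⟨i, rfl⟩
      exact ⟨Or.inl ⟨i, rfl⟩, fun ⟨i', h⟩ => f.left_ne_right hj i i' h.symm⟩
    · exact fun h => h.1.resolve_right h.2
  rw [key, key, hr]

/-- Every admissible pair of columns `u` and `v` comes from a tableau. -/
theorem exists_columns (hj : j ≤ n) (hjm : j ≤ n - j) {u : Fin (n - j) → ℕ} {v : Fin j → ℕ}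
    (hu : StrictMono u) (hv : StrictMono v) (hd : ∀ i i', u i ≠ v i')
    (hn : ∀ x, x < n ↔ (∃ i, u i = x) ∨ ∃ i, v i = x)
    (huv : ∀ i : Fin j, u (i.castLE hjm) < v i) :
    ∃ f : HookShapeSYT n j, f.left = u ∧ f.right hj = v := by
  have hu' (i) : u i < n := (hn _).2 (Or.inl ⟨i, rfl⟩)
  have hv' (i) : v i < n := (hn _).2 (Or.inr ⟨i, rfl⟩)
  obtain ⟨F, hFl, hFr⟩ : ∃ F : {rc : Fin n × Fin 2 // hookShapeCell n j rc} → Fin n,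
      (∀ i, F (leftCell i) = ⟨u i, hu' i⟩) ∧ ∀ i, F (rightCell hj i) = ⟨v i, hv' i⟩ := by
    refine ⟨fun a => if h : (a.1.1 : ℕ) < n - j ∧ a.1.2 = 0 then ⟨u ⟨a.1.1, h.1⟩, hu' _⟩ else
      if h : (a.1.1 : ℕ) < j then ⟨v ⟨a.1.1, h⟩, hv' _⟩ else a.1.1, fun i => ?_, fun i => ?_⟩
    · simp [leftCell]
    · simp [rightCell]
  refine ⟨⟨F, ⟨fun a b hab => ?_, fun y => ?_⟩, fun a b hab hlt => ?_, fun a b hab hlt => ?_⟩,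
    funext fun i => congrArg Fin.val (hFl i), funext fun i => congrArg Fin.val (hFr i)⟩
  · rcases cell_cases hj a with ⟨i, rfl⟩ | ⟨i, rfl⟩ <;>
      rcases cell_cases hj b with ⟨i', rfl⟩ | ⟨i', rfl⟩ <;>
      simp only [hFl, hFr, Fin.mk.injEq] at hab
    · rw [hu.injective hab]
    · exact absurd hab (hd _ _)
    · exact absurd hab.symm (hd _ _)
    · rw [hv.injective hab]
  · rcases (hn y).1 y.2 with ⟨i, hi⟩ | ⟨i, hi⟩
    · exact ⟨leftCell i, by rw [hFl]; exact Fin.ext hi⟩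
    · exact ⟨rightCell hj i, by rw [hFr]; exact Fin.ext hi⟩
  · rcases cell_cases hj a with ⟨i, rfl⟩ | ⟨i, rfl⟩ <;>
      rcases cell_cases hj b with ⟨i', rfl⟩ | ⟨i', rfl⟩
    · simp [leftCell] at hlt
    · rw [hFl, hFr]
      have : i = i'.castLE hjm := Fin.ext (by simpa [leftCell, rightCell] using hab)
      rw [this]
      exact huv i'
    · simp [leftCell, rightCell] at hlt
    · simp [rightCell] at hlt
  · rcases cell_cases hj a with ⟨i, rfl⟩ | ⟨i, rfl⟩ <;>
      rcases cell_cases hj b with ⟨i', rfl⟩ | ⟨i', rfl⟩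
    · rw [hFl, hFl]
      exact hu hlt
    · simp [leftCell, rightCell] at hab
    · simp [leftCell, rightCell] at hab
    · rw [hFr, hFr]
      exact hv hlt

theorem exists_rightSet_eq (hj : j ≤ n) (hjm : j ≤ n - j) {S : Finset ℕ}
    (hS : S ∈ ballotSets n j) : ∃ f : HookShapeSYT n j, f.rightSet hj = S := by
  obtain ⟨⟨hSn, hc⟩, hb⟩ := mem_ballotSets.1 hS
  have hc' : #(range n \ S) = n - j := by rw [card_sdiff_of_subset hSn, card_range, hc]
  set u := (range n \ S).orderEmbOfFin hc' with hu
  set v := S.orderEmbOfFin hc with hv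
  have hvS : univ.image v = S := image_orderEmbOfFin_univ S hc
  have hmu (x) : (∃ i, u i = x) ↔ x < n ∧ x ∉ S := by
    rw [← Set.mem_range, hu, range_orderEmbOfFin]
    simp
  have hmv (x) : (∃ i, v i = x) ↔ x ∈ S := by
    rw [← Set.mem_range, hv, range_orderEmbOfFin, mem_coe]
  have hd (i i') : u i ≠ v i' := fun h =>
    ((hmu _).1 ⟨i, rfl⟩).2 (h ▸ (hmv _).1 ⟨i', rfl⟩)
  have hn (x) : x < n ↔ (∃ i, u i = x) ∨ ∃ i, v i = x := by
    have : x ∈ S → x < n := fun h => mem_range.1 (hSn h)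
    rw [hmu, hmv]
    tauto
  obtain ⟨f, -, hf⟩ := exists_columns hj hjm u.strictMono v.strictMono hd hn
    ((isBallot_image_iff hjm u.strictMono v.strictMono hd hn).1 (hvS.symm ▸ hb))
  exact ⟨f, by rw [rightSet, hf, hvS]⟩

theorem card_eq_card_ballotSets (h : 2 * j ≤ n) :
    Nat.card (HookShapeSYT n j) = #(ballotSets n j) := by
  have hj : j ≤ n := by omega
  have hjm : j ≤ n - j := by omega
  rw [← Fintype.card_coe, ← Nat.card_eq_fintype_card]
  refine Nat.card_eq_of_bijective
    (fun f => ⟨f.rightSet hj, f.rightSet_mem_ballotSets hj hjm⟩) ⟨fun f g hfg => ?_, fun S => ?_⟩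
  · exact rightSet_injective hj (congrArg Subtype.val hfg)
  · obtain ⟨f, hf⟩ := exists_rightSet_eq hj hjm S.2
    exact ⟨f, Subtype.ext hf⟩

end HookShapeSYT

/-- For `1 ≤ j` and `2j ≤ n`, the number of standard Young tableaux
of shape `(2^j, 1^{n−2j})` equals `binom(n,j) − binom(n,j−1)`. -/
theorem card_hookShapeSYT (n j : ℕ) (h1 : 1 ≤ j) (h2 : 2 * j ≤ n) :
    Nat.card (HookShapeSYT n j) = n.choose j - n.choose (j - 1) := by
  obtain ⟨i, rfl⟩ := Nat.exists_eq_add_of_le' h1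
  have := card_ballotSets_add_choose n i (by omega)
  rw [HookShapeSYT.card_eq_card_ballotSets h2, Nat.add_sub_cancel]
  omega
end

section
/- Let S ⊆ {1, …, m} and let Π be the orthogonal projection of V onto ⊕_{k∈S} V_k; suppose Π commutes with R(g) for every g ∈ G. Then the shadow estimator with Y = Π satisfies E[ô] = Tr[ρΠ] and Var[ô] = Tr[ρΠ]·(1 − Tr[ρΠ]) ≤ 1/4 for every density matrix ρ. -/
open Matrix
open scoped BigOperators ComplexOrder

noncomputable section

/-- The probability `p(g,i) = (1/|G|) ⟨w_i, R(g) ρ R(g)* w_i⟩` of the single-shot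
outcome `(g, i)`. -/
def prob {G : Type*} [Group G] [Fintype G] {d : ℕ}
    (R : G →* Matrix.unitaryGroup (Fin d) ℂ) (w : Fin d → Fin d → ℂ)
    (ρ : Matrix (Fin d) (Fin d) ℂ) (g : G) (i : Fin d) : ℝ :=
  (((Fintype.card G : ℂ))⁻¹ *
    ∑ x, star (w i x) *
      (((R g : Matrix (Fin d) (Fin d) ℂ) * ρ *
          star (R g : Matrix (Fin d) (Fin d) ℂ)).mulVec (w i)) x).re

/-- The single-shot estimator value `ô(g,i) = ⟨w_i, R(g) Y R(g)* w_i⟩`. -/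
def est {G : Type*} [Group G] [Fintype G] {d : ℕ}
    (R : G →* Matrix.unitaryGroup (Fin d) ℂ) (w : Fin d → Fin d → ℂ)
    (Y : Matrix (Fin d) (Fin d) ℂ) (g : G) (i : Fin d) : ℝ :=
  (∑ x, star (w i x) *
      (((R g : Matrix (Fin d) (Fin d) ℂ) * Y *
          star (R g : Matrix (Fin d) (Fin d) ℂ)).mulVec (w i)) x).re

/-- The mean `E[ô] = Σ_{g,i} p(g,i) ô(g,i)` of the single-shot estimator. -/
def mean {G : Type*} [Group G] [Fintype G] {d : ℕ}
    (R : G →* Matrix.unitaryGroup (Fin d) ℂ) (w : Fin d → Fin d → ℂ)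
    (ρ Y : Matrix (Fin d) (Fin d) ℂ) : ℝ :=
  ∑ g : G, ∑ i : Fin d, prob R w ρ g i * est R w Y g i

/-- The variance `Var[ô] = Σ_{g,i} p(g,i) ô(g,i)² − (E[ô])²` of the single-shot
estimator. -/
def variance {G : Type*} [Group G] [Fintype G] {d : ℕ}
    (R : G →* Matrix.unitaryGroup (Fin d) ℂ) (w : Fin d → Fin d → ℂ)
    (ρ Y : Matrix (Fin d) (Fin d) ℂ) : ℝ :=
  (∑ g : G, ∑ i : Fin d, prob R w ρ g i * (est R w Y g i) ^ 2) - (mean R w ρ Y) ^ 2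

/-- The diagonal matrix elements of `A` in an orthonormal basis add up to its trace. -/
theorem sum_star_mul_mulVec_eq_trace {d : ℕ} (w : Fin d → Fin d → ℂ)
    (horth : ∀ i j, (∑ x, star (w i x) * w j x) = if i = j then 1 else 0)
    (A : Matrix (Fin d) (Fin d) ℂ) :
    ∑ i, ∑ x, star (w i x) * (A.mulVec (w i)) x = A.trace := by
  have hW : (Matrix.of w)ᵀᴴ * (Matrix.of w)ᵀ = 1 := by
    ext i j
    simpa [Matrix.mul_apply, Matrix.one_apply] using horth i j
  have htr : ((Matrix.of w)ᵀᴴ * (A * (Matrix.of w)ᵀ)).trace = A.trace := by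
    rw [Matrix.trace_mul_comm, Matrix.mul_assoc, mul_eq_one_comm.mp hW, Matrix.mul_one]
  rw [← htr]
  simp [Matrix.trace, Matrix.mul_apply, Matrix.mulVec, dotProduct]

/-- A sum of mutually orthogonal projections acts on a vector in the range of one of them
as `1` or `0`. -/
theorem sum_projections_mulVec {d m : ℕ} (P : Fin m → Matrix (Fin d) (Fin d) ℂ)
    (hPorth : ∀ k l, k ≠ l → P k * P l = 0) (S : Finset (Fin m)) (k : Fin m)
    (v : Fin d → ℂ) (hv : (P k).mulVec v = v) :
    (∑ l ∈ S, P l).mulVec v = (if k ∈ S then (1 : ℂ) else 0) • v := by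
  have hl : ∀ l, (P l).mulVec v = if l = k then v else 0 := by
    intro l
    split_ifs with h
    · rw [h, hv]
    · rw [← hv, Matrix.mulVec_mulVec, hPorth l k h, Matrix.zero_mulVec]
  rw [Matrix.sum_mulVec]
  simp [hl]

/-- If `Y` commutes with the representation and is diagonal in the measurement basis, the
estimator returns its eigenvalues. -/
theorem est_eq_of_eigenbasis {G : Type*} [Group G] [Fintype G] {d : ℕ}
    (R : G →* Matrix.unitaryGroup (Fin d) ℂ) (w : Fin d → Fin d → ℂ)
    (horth : ∀ i j, (∑ x, star (w i x) * w j x) = if i = j then 1 else 0)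
    (Y : Matrix (Fin d) (Fin d) ℂ)
    (hcomm : ∀ g : G, (R g : Matrix (Fin d) (Fin d) ℂ) * Y
        = Y * (R g : Matrix (Fin d) (Fin d) ℂ))
    (c : Fin d → ℝ) (hY : ∀ i, Y.mulVec (w i) = (c i : ℂ) • w i) (g : G) (i : Fin d) :
    est R w Y g i = c i := by
  have hR : (R g : Matrix (Fin d) (Fin d) ℂ) * star (R g : Matrix (Fin d) (Fin d) ℂ) = 1 :=
    Unitary.mul_star_self_of_mem (R g).2
  have hsum : ∑ x, star (w i x) * ((c i : ℂ) * w i x) = c i := by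
    simp_rw [mul_left_comm _ (c i : ℂ)]
    rw [← Finset.mul_sum, horth]
    simp
  unfold est
  rw [hcomm, Matrix.mul_assoc, hR, Matrix.mul_one, hY]
  simp only [Pi.smul_apply, smul_eq_mul]
  rw [hsum, Complex.ofReal_re]

/-- If `Y` commutes with the representation and is diagonal in the measurement basis, the
expectation of its eigenvalues under the outcome distribution is `Tr[ρY]`. -/
theorem sum_prob_mul_eq_trace {G : Type*} [Group G] [Fintype G] {d : ℕ}
    (R : G →* Matrix.unitaryGroup (Fin d) ℂ) (w : Fin d → Fin d → ℂ)
    (horth : ∀ i j, (∑ x, star (w i x) * w j x) = if i = j then 1 else 0)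
    (ρ Y : Matrix (Fin d) (Fin d) ℂ)
    (hcomm : ∀ g : G, (R g : Matrix (Fin d) (Fin d) ℂ) * Y
        = Y * (R g : Matrix (Fin d) (Fin d) ℂ))
    (c : Fin d → ℝ) (hY : ∀ i, Y.mulVec (w i) = (c i : ℂ) • w i) :
    ∑ g : G, ∑ i, prob R w ρ g i * c i = ((ρ * Y).trace).re := by
  have hg : ∀ g : G, ∑ i, prob R w ρ g i * c i
      = ((Fintype.card G : ℂ)⁻¹ * (ρ * Y).trace).re := by
    intro g
    set U : Matrix (Fin d) (Fin d) ℂ := (R g : Matrix (Fin d) (Fin d) ℂ) with hU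
    have hR : star U * U = 1 := Unitary.star_mul_self_of_mem (R g).2
    have htr : (U * ρ * star U * Y).trace = (ρ * Y).trace := by
      calc (U * ρ * star U * Y).trace = (U * (ρ * star U * Y)).trace := by
            simp only [Matrix.mul_assoc]
        _ = (ρ * star U * (Y * U)).trace := by
            rw [Matrix.trace_mul_comm, Matrix.mul_assoc]
        _ = (ρ * (star U * U) * Y).trace := by
            rw [← hcomm g]
            simp only [Matrix.mul_assoc, hU]
        _ = (ρ * Y).trace := by rw [hR, Matrix.mul_one]
    rw [← htr, ← sum_star_mul_mulVec_eq_trace w horth, Finset.mul_sum, Complex.re_sum]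
    refine Finset.sum_congr rfl fun i _ => ?_
    rw [← Matrix.mulVec_mulVec, hY, Matrix.mulVec_smul, prob, ← Complex.re_mul_ofReal,
      mul_assoc, Finset.sum_mul]
    simp only [Pi.smul_apply, smul_eq_mul]
    congr 2
    refine Finset.sum_congr rfl fun x _ => ?_
    ring
  have hcard : (Fintype.card G : ℂ) ≠ 0 := Nat.cast_ne_zero.mpr Fintype.card_ne_zero
  rw [Finset.sum_congr rfl fun g _ => hg g, ← Complex.re_sum, Finset.sum_const,
    Finset.card_univ, nsmul_eq_mul, mul_inv_cancel_left₀ hcard]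

/-- Let `R : G → U(d)` be a unitary representation of a finite group
`G` on `ℂ^d`, decomposed into orthogonal irreducible invariant summands with
projections `P k`, with an adapted orthonormal measurement basis `w`.  Let
`Π = Σ_{k∈S} P k` be the orthogonal projection onto a union of summands, and suppose
`Π` commutes with every `R g`.  Then the shadow estimator with `Y = Π` satisfies
`E[ô] = Tr[ρΠ]` and `Var[ô] = Tr[ρΠ](1 − Tr[ρΠ]) ≤ 1/4` for every density matrix. -/
theorem shadow_estimator_isotypic_projector
    (G : Type*) [Group G] [Fintype G] (d m : ℕ)
    (R : G →* Matrix.unitaryGroup (Fin d) ℂ)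
    -- the orthogonal projections onto the summands V_1, ..., V_m
    (P : Fin m → Matrix (Fin d) (Fin d) ℂ)
    (hPproj : ∀ k, P k * P k = P k)
    (hPsa : ∀ k, (P k)ᴴ = P k)
    (hPorth : ∀ k l, k ≠ l → P k * P l = 0)
    (hPsum : ∑ k, P k = 1)
    (hPinv : ∀ (g : G) k, (R g : Matrix (Fin d) (Fin d) ℂ) * P k
        = P k * (R g : Matrix (Fin d) (Fin d) ℂ))
    -- each summand is irreducible as a G-module
    (hirr : ∀ k (Q : Matrix (Fin d) (Fin d) ℂ), Q * Q = Q → Qᴴ = Q →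
        Q * P k = Q → P k * Q = Q →
        (∀ g : G, (R g : Matrix (Fin d) (Fin d) ℂ) * Q
          = Q * (R g : Matrix (Fin d) (Fin d) ℂ)) →
        Q = 0 ∨ Q = P k)
    -- an orthonormal basis adapted to the decomposition
    (w : Fin d → Fin d → ℂ)
    (horth : ∀ i j, (∑ x, star (w i x) * w j x) = if i = j then 1 else 0)
    (k : Fin d → Fin m)
    (hadapt : ∀ i, (P (k i)).mulVec (w i) = w i)
    -- the projector Π onto a union of summands, commuting with the representation
    (S : Finset (Fin m))
    (hcomm : ∀ g : G, (R g : Matrix (Fin d) (Fin d) ℂ) * (∑ l ∈ S, P l)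
        = (∑ l ∈ S, P l) * (R g : Matrix (Fin d) (Fin d) ℂ))
    -- a density matrix
    (ρ : Matrix (Fin d) (Fin d) ℂ)
    (hρ : ρ.PosSemidef) (hρtr : ρ.trace = 1) :
    mean R w ρ (∑ l ∈ S, P l) = ((ρ * ∑ l ∈ S, P l).trace).re ∧
    variance R w ρ (∑ l ∈ S, P l)
      = ((ρ * ∑ l ∈ S, P l).trace).re * (1 - ((ρ * ∑ l ∈ S, P l).trace).re) ∧
    variance R w ρ (∑ l ∈ S, P l) ≤ 1 / 4 := by
  set c : Fin d → ℝ := fun i => if k i ∈ S then 1 else 0 with hc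
  have hY : ∀ i, (∑ l ∈ S, P l).mulVec (w i) = (c i : ℂ) • w i := by
    intro i
    rw [sum_projections_mulVec P hPorth S (k i) (w i) (hadapt i)]
    by_cases h : k i ∈ S <;> simp [hc, h]
  have hest := est_eq_of_eigenbasis R w horth _ hcomm c hY
  have hsum := sum_prob_mul_eq_trace R w horth ρ _ hcomm c hY
  have hcsq : ∀ i, c i ^ 2 = c i := by
    intro i
    simp [hc]
  have hmean : mean R w ρ (∑ l ∈ S, P l) = ((ρ * ∑ l ∈ S, P l).trace).re := by
    simp only [mean, hest, hsum]
  have hvar : variance R w ρ (∑ l ∈ S, P l)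
      = ((ρ * ∑ l ∈ S, P l).trace).re * (1 - ((ρ * ∑ l ∈ S, P l).trace).re) := by
    simp only [variance, hest, hcsq, hsum, hmean]
    ring
  refine ⟨hmean, hvar, ?_⟩
  rw [hvar]
  nlinarith [sq_nonneg (((ρ * ∑ l ∈ S, P l).trace).re - 1 / 2)]
end
end
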